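/- There exist absolute constants c > 0, c' > 0 and n₀ ∈ ℕ such that for all n ≥ n₀ the following holds. If K ⊆ ℝⁿ is a centrally symmetric convex set (viewed as a ±1-valued function) with |vol(K) − 1/2| ≤ c/√n, then its Hermite weight at level 2 satisfies W^{=2}[K] ≥ c'/n. -/

import Mathlib

open MeasureTheory ProbabilityTheory

/-- The standard Gaussian measure `N(0,1)ⁿ` on `ℝⁿ`. -/
noncomputable def stdGaussian (n : ℕ) : Measure (EuclideanSpace ℝ (Fin n)) :=
  (Measure.pi fun _ : Fin n => gaussianReal 0 1).map
    (EuclideanSpace.equiv (Fin n) ℝ).symm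

open Classical in
/-- The `±1`-valued function associated to a set `K`. -/
noncomputable def pmInd {n : ℕ} (K : Set (EuclideanSpace ℝ (Fin n)))
    (x : EuclideanSpace ℝ (Fin n)) : ℝ :=
  if x ∈ K then 1 else -1

/-- The normalized probabilists' Hermite polynomial `h_d(x) = He_d(x)/√(d!)`,
orthonormal with respect to `N(0,1)`. -/
noncomputable def normHermite (d : ℕ) (x : ℝ) : ℝ :=
  (Polynomial.aeval x (Polynomial.hermite d)) / Real.sqrt (Nat.factorial d)

/-- The Hermite coefficient `f̃(S) = E_{g ∼ N(0,1)ⁿ}[f(g) · ∏ᵢ h_{Sᵢ}(gᵢ)]`. -/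
noncomputable def hermiteCoeff (n : ℕ) (f : EuclideanSpace ℝ (Fin n) → ℝ)
    (S : Fin n → ℕ) : ℝ :=
  ∫ x, f x * ∏ i, normHermite (S i) (x i) ∂(stdGaussian n)

/-- The Hermite weight of `f` at level `j`: `W^{=j}[f] = Σ_{|S| = j} f̃(S)²`. -/
noncomputable def hermiteWeight (n : ℕ) (f : EuclideanSpace ℝ (Fin n) → ℝ)
    (j : ℕ) : ℝ :=
  ∑' S : {S : Fin n → ℕ // ∑ i, S i = j}, (hermiteCoeff n f S.1) ^ 2

/-- The Gaussian volume of `K ⊆ ℝⁿ`. -/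
noncomputable def gaussVol (n : ℕ) (K : Set (EuclideanSpace ℝ (Fin n))) : ℝ :=
  (stdGaussian n K).toReal

section Geometry

variable {E : Type*} [NormedAddCommGroup E] [InnerProductSpace ℝ E]

/-- A supporting functional of a convex body, normalised so that it attains the gauge at `x`. -/
theorem exists_strongDual_eq_gauge_le_gauge {K : Set E} (hK : Convex ℝ K) (h0 : K ∈ nhds 0)
    {x : E} (hx : 0 < gauge K x) :
    ∃ f : StrongDual ℝ E, f x = gauge K x ∧ ∀ y, f y ≤ gauge K y := by
  have habs : Absorbent ℝ K := absorbent_nhds_zero h0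
  obtain ⟨g, hg⟩ := geometric_hahn_banach_open_point (s := {y | gauge K y < gauge K x}) (x := x)
    (fun y hy z hz a b ha hb hab => by
      simp only [Set.mem_ofPred_eq] at hy hz ⊢
      have h1 := gauge_add_le hK habs (a • y) (b • z)
      rw [gauge_smul_of_nonneg ha, gauge_smul_of_nonneg hb, smul_eq_mul, smul_eq_mul] at h1
      rcases ha.eq_or_lt with rfl | ha'
      · have : b = 1 := by linarith
        subst this
        linarith
      · nlinarith [mul_lt_mul_of_pos_left hy ha', mul_le_mul_of_nonneg_left hz.le hb])
    (isOpen_lt (continuous_gauge hK h0) continuous_const) (by simp)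
  have hgx : 0 < g x := by simpa using hg 0 (by simpa using hx)
  have hfx : ((gauge K x / g x) • g) x = gauge K x := by
    simp [hgx.ne']
  refine ⟨(gauge K x / g x) • g, hfx, fun y => ?_⟩
  by_contra! hlt
  have hgy : 0 < g y := by
    have h1 : 0 < (gauge K x / g x) * g y := (gauge_nonneg y).trans_lt (by simpa using hlt)
    exact (pos_iff_pos_of_mul_pos h1).1 (by positivity)
  have h2 := hg ((g x / g y) • y) (by
    simp only [Set.mem_ofPred_eq]
    rw [gauge_smul_of_nonneg (by positivity), smul_eq_mul, div_mul_eq_mul_div, div_lt_iff₀ hgy]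
    simp only [smul_apply, smul_eq_mul] at hlt
    rw [div_mul_eq_mul_div, lt_div_iff₀ hgx] at hlt
    linarith)
  simp [hgy.ne'] at h2

theorem opNorm_le_of_le_gauge {K : Set E} {r : ℝ} (hr : 0 < r) (hK : Metric.ball 0 r ⊆ K)
    {f : StrongDual ℝ E} (hf : ∀ y, f y ≤ gauge K y) : ‖f‖ ≤ r⁻¹ := by
  have key : ∀ y, f y ≤ r⁻¹ * ‖y‖ := fun y => by
    have := mul_gauge_le_norm hK (x := y)
    rw [inv_mul_eq_div, le_div_iff₀ hr]
    nlinarith [hf y]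
  refine f.opNorm_le_bound (by positivity) fun y => ?_
  rw [Real.norm_eq_abs, abs_le]
  have := key (-y)
  simp only [map_neg, norm_neg] at this
  exact ⟨by linarith, key y⟩

end Geometry

section Rotation

variable {E : Type*} [NormedAddCommGroup E] [InnerProductSpace ℝ E] [FiniteDimensional ℝ E]
  [MeasurableSpace E] [BorelSpace E]

theorem map_strongDual_stdGaussian (f : StrongDual ℝ E) :
    (ProbabilityTheory.stdGaussian E).map f = (gaussianReal 0 1).map (‖f‖ * ·) := by
  rw [IsGaussian.map_eq_gaussianReal, integral_strongDual_stdGaussian, variance_dual_stdGaussian,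
    gaussianReal_map_const_mul]
  congr 1
  · simp
  · ext; simp

/-- A symmetric closed convex set of Gaussian measure at least `1/4` has inradius
at least `1/4`. -/
theorem ball_subset_of_stdGaussian_ge {K : Set E} (hK : Convex ℝ K) (hc : IsClosed K)
    (hs : ∀ x ∈ K, -x ∈ K) (hv : 1 / 4 ≤ (ProbabilityTheory.stdGaussian E).real K) :
    Metric.ball 0 (1 / 4) ⊆ K := by
  intro y hy
  by_contra hyK
  obtain ⟨f, u, hfu, huy⟩ := geometric_hahn_banach_closed_point hK hc hyK
  have hne : K.Nonempty := by
    by_contra! h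
    simp [h] at hv
    linarith
  obtain ⟨z, hz⟩ := hne
  have hu : 0 < u := by
    have h1 := hfu z hz
    have h2 := hfu _ (hs z hz)
    simp only [map_neg] at h2
    linarith
  have hfy : f y ≤ ‖f‖ * ‖y‖ := (le_abs_self _).trans (f.le_opNorm y)
  have hfpos : 0 < ‖f‖ := by
    by_contra! h
    have : ‖f‖ = 0 := le_antisymm h (norm_nonneg _)
    rw [this] at hfy
    linarith
  set s := ‖y‖ with hsdef
  have hs4 : s < 1 / 4 := by simpa using hy
  have hsub : K ⊆ f ⁻¹' Set.Icc (-(‖f‖ * s)) (‖f‖ * s) := by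
    intro w hw
    have h1 := hfu w hw
    have h2 := hfu _ (hs w hw)
    simp only [map_neg] at h2
    constructor <;> linarith
  have h1 : (ProbabilityTheory.stdGaussian E) K ≤ gaussianReal 0 1 (Set.Icc (-s) s) := by
    calc _ ≤ _ := measure_mono hsub
      _ = ((ProbabilityTheory.stdGaussian E).map f) (Set.Icc (-(‖f‖ * s)) (‖f‖ * s)) := by
        rw [Measure.map_apply (by fun_prop) measurableSet_Icc]
      _ = _ := by
        rw [map_strongDual_stdGaussian, Measure.map_apply (by fun_prop) measurableSet_Icc]
        congr 1
        ext t
        simp only [Set.mem_preimage, Set.mem_Icc]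
        rw [← mul_neg, mul_le_mul_iff_right₀ hfpos, mul_le_mul_iff_right₀ hfpos]
  have h2 : gaussianReal 0 1 (Set.Icc (-s) s) ≤ ENNReal.ofReal s := by
    rw [gaussianReal_apply 0 one_ne_zero]
    calc _ ≤ ∫⁻ _ in Set.Icc (-s) s, ENNReal.ofReal (1 / 2) := by
          refine lintegral_mono fun t => ?_
          rw [gaussianPDF]
          refine ENNReal.ofReal_le_ofReal ?_
          rw [gaussianPDFReal]
          have e1 : Real.exp (-(t - 0) ^ 2 / (2 * ((1 : NNReal) : ℝ))) ≤ 1 := by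
            rw [Real.exp_le_one_iff]
            have := sq_nonneg (t - 0)
            simp only [NNReal.coe_one]
            linarith
          have e2 : (2 : ℝ) ≤ √(2 * Real.pi * ((1 : NNReal) : ℝ)) := by
            apply Real.le_sqrt_of_sq_le
            simp only [NNReal.coe_one]
            nlinarith [Real.pi_gt_three]
          calc _ ≤ (√(2 * Real.pi * ((1 : NNReal) : ℝ)))⁻¹ * 1 := by gcongr
            _ ≤ (2 : ℝ)⁻¹ * 1 := by gcongr
            _ = _ := by norm_num
      _ = _ := by
          rw [setLIntegral_const, Real.volume_Icc, ← ENNReal.ofReal_mul (by norm_num)]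
          congr 1
          ring
  have h3 : (ProbabilityTheory.stdGaussian E).real K ≤ s :=
    ENNReal.toReal_le_of_le_ofReal (norm_nonneg _) (h1.trans h2)
  linarith

/-- For `X` outside a convex body containing `ball 0 (1/4)`, the probability that a rotation
of `X` by a small angle towards an independent Gaussian vector lies in the body. -/
theorem stdGaussian_rotation_mem_le {K : Set E} (hK : Convex ℝ K)
    (hb : Metric.ball 0 (1 / 4) ⊆ K) {x : E} (hx : 1 < gauge K x) {τ : ℝ} (h0 : 0 ≤ τ)
    (h1 : τ ≤ 1) :
    ProbabilityTheory.stdGaussian E {y | Real.cos τ • x + Real.sin τ • y ∈ K} ≤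
      gaussianReal 0 1 {g | gauge K x ≤ 1 + τ ^ 2 + 8 * τ * |g|} := by
  have hn : K ∈ nhds 0 := Filter.mem_of_superset (Metric.ball_mem_nhds 0 (by norm_num)) hb
  obtain ⟨f, hfx, hf⟩ := exists_strongDual_eq_gauge_le_gauge hK hn (zero_lt_one.trans hx)
  have hf4 : ‖f‖ ≤ 4 := by
    simpa using opNorm_le_of_le_gauge (by norm_num) hb hf
  have hcos := Real.one_sub_sq_div_two_le_cos (x := τ)
  have hsin : Real.sin τ ≤ τ := Real.sin_le h0
  have hsin0 : 0 ≤ Real.sin τ := Real.sin_nonneg_of_nonneg_of_le_pi h0 (by linarith [Real.pi_gt_three])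
  calc _ ≤ ProbabilityTheory.stdGaussian E (f ⁻¹' {t | gauge K x ≤ 1 + τ ^ 2 + 2 * τ * |t|}) := by
        refine measure_mono fun y hy => ?_
        have h2 := (hf _).trans (gauge_le_one_of_mem hy)
        simp only [map_add, map_smul, smul_eq_mul, hfx] at h2
        simp only [Set.mem_preimage, Set.mem_ofPred_eq]
        set ρ := gauge K x
        have h3 : - (τ * |f y|) ≤ Real.sin τ * f y := by
          have := neg_abs_le (Real.sin τ * f y)
          rw [abs_mul, abs_of_nonneg hsin0] at this
          nlinarith [abs_nonneg (f y)]
        have h4 : (1 - τ ^ 2 / 2) * ρ ≤ 1 + τ * |f y| := by nlinarith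
        have h5 : 0 ≤ τ * |f y| := by positivity
        have h6 : 1 + τ * |f y| ≤ (1 - τ ^ 2 / 2) * (1 + τ ^ 2 + 2 * τ * |f y|) := by
          have : τ ^ 2 ≤ 1 := by nlinarith
          nlinarith [mul_nonneg h5 (sub_nonneg.2 this), sq_nonneg τ]
        exact le_of_mul_le_mul_left (h4.trans h6) (by nlinarith)
    _ = ((ProbabilityTheory.stdGaussian E).map f) {t | gauge K x ≤ 1 + τ ^ 2 + 2 * τ * |t|} := by
        rw [Measure.map_apply (by fun_prop)]
        exact measurableSet_le (by fun_prop) (by fun_prop)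
    _ = gaussianReal 0 1 ((‖f‖ * ·) ⁻¹' {t | gauge K x ≤ 1 + τ ^ 2 + 2 * τ * |t|}) := by
        rw [map_strongDual_stdGaussian, Measure.map_apply (by fun_prop)]
        exact measurableSet_le (by fun_prop) (by fun_prop)
    _ ≤ _ := by
        refine measure_mono fun g hg => ?_
        simp only [Set.mem_preimage, Set.mem_ofPred_eq, abs_mul, abs_norm] at hg ⊢
        have := mul_le_mul_of_nonneg_right hf4 (abs_nonneg g)
        nlinarith [mul_le_mul_of_nonneg_left this h0]

/-- The probability that a rotation by the angle `τ` of two independent Gaussian vectors moves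
the first one from outside `K` into `K`. -/
noncomputable def crossingProb (K : Set E) (τ : ℝ) : ℝ :=
  ((ProbabilityTheory.stdGaussian E).prod (ProbabilityTheory.stdGaussian E)).real
    {p | p.1 ∉ K ∧ Real.cos τ • p.1 + Real.sin τ • p.2 ∈ K}

theorem crossingProb_add_le {K : Set E} (hK : MeasurableSet K) (α β : ℝ) :
    crossingProb K (α + β) ≤ crossingProb K α + crossingProb K β := by
  set μ := (ProbabilityTheory.stdGaussian E).prod (ProbabilityTheory.stdGaussian E) with hμ
  have hrot : μ.map (ContinuousLinearMap.rotation α) = μ :=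
    IsGaussian.map_rotation_eq_self_of_forall_strongDual_eq_zero
      integral_strongDual_stdGaussian α
  have hm : MeasurableSet {p : E × E | p.1 ∉ K ∧ Real.cos β • p.1 + Real.sin β • p.2 ∈ K} := by
    refine MeasurableSet.inter (measurable_fst hK.compl) ?_
    exact (show Measurable fun p : E × E => Real.cos β • p.1 + Real.sin β • p.2 by fun_prop) hK
  have h1 : crossingProb K β = μ.real
      (ContinuousLinearMap.rotation α ⁻¹'
        {p : E × E | p.1 ∉ K ∧ Real.cos β • p.1 + Real.sin β • p.2 ∈ K}) := by
    rw [crossingProb, ← hμ, Measure.real, Measure.real]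
    conv_lhs => rw [← hrot]
    rw [Measure.map_apply (by fun_prop) hm]
  rw [h1]
  refine le_trans (measureReal_mono ?_) (measureReal_union_le _ _)
  rintro ⟨x, y⟩ ⟨hx, hy⟩
  simp only [Set.mem_union, Set.mem_ofPred_eq, Set.mem_preimage,
    ContinuousLinearMap.rotation_apply] at hx hy ⊢
  by_cases h : Real.cos α • x + Real.sin α • y ∈ K
  · exact Or.inl ⟨hx, h⟩
  · refine Or.inr ⟨h, ?_⟩
    convert hy using 1
    rw [Real.cos_add, Real.sin_add]
    module

theorem crossingProb_nat_mul_le {K : Set E} (hK : MeasurableSet K) (τ : ℝ) (N : ℕ) :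
    crossingProb K (N * τ) ≤ N * crossingProb K τ := by
  induction N with
  | zero => simp [crossingProb]
  | succ N ih =>
    have := crossingProb_add_le hK (N * τ) τ
    push_cast
    rw [add_mul, one_mul, add_mul, one_mul]
    linarith

theorem crossingProb_pi_div_two (K : Set E) (hK : MeasurableSet K) :
    crossingProb K (Real.pi / 2) = (1 - (ProbabilityTheory.stdGaussian E).real K) *
      (ProbabilityTheory.stdGaussian E).real K := by
  rw [← probReal_compl_eq_one_sub hK, ← measureReal_prod_prod, crossingProb]
  congr 1
  ext p
  simp

end Rotation

section Growth

theorem gaussianReal_map_inv_mul_eq_withDensity {t : ℝ} (ht : 0 < t) :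
    (gaussianReal 0 1).map (t⁻¹ * ·) = (gaussianReal 0 1).withDensity
      fun x => ENNReal.ofReal (t * Real.exp (-((t ^ 2 - 1) * x ^ 2 / 2))) := by
  have hv : (NNReal.mk ((t⁻¹) ^ 2) (sq_nonneg _) * 1 : NNReal) ≠ 0 := by
    intro h
    have := congrArg NNReal.toReal h
    simp [ht.ne'] at this
  rw [gaussianReal_map_const_mul, gaussianReal_of_var_ne_zero _ hv,
    gaussianReal_of_var_ne_zero _ one_ne_zero, ← withDensity_mul _ (by fun_prop) (by fun_prop)]
  congr 1
  ext x
  simp only [Pi.mul_apply, gaussianPDF]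
  rw [← ENNReal.ofReal_mul (gaussianPDFReal_nonneg _ _ _)]
  congr 1
  simp only [gaussianPDFReal, NNReal.coe_mk, NNReal.coe_one, mul_one, mul_zero,
    sub_zero]
  rw [Real.sqrt_mul (by positivity), Real.sqrt_sq (by positivity)]
  rw [mul_inv, inv_inv, mul_assoc, mul_assoc, mul_left_comm (Real.exp _), ← Real.exp_add]
  congr 3
  field_simp
  ring

theorem lintegral_pi_prod {n : ℕ} {μ : Fin n → Measure ℝ} [∀ i, IsProbabilityMeasure (μ i)]
    {f : Fin n → ℝ → ENNReal} (hf : ∀ i, Measurable (f i)) :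
    ∫⁻ x, ∏ i, f i (x i) ∂Measure.pi μ = ∏ i, ∫⁻ x, f i x ∂μ i := by
  rw [lintegral_prod_eq_prod_lintegral_of_indepFun Finset.univ
    (fun i (x : Fin n → ℝ) => f i (x i)) (iIndepFun_pi fun i => (hf i).aemeasurable)
    (fun i => (hf i).comp (measurable_pi_apply i))]
  refine Finset.prod_congr rfl fun i _ => ?_
  rw [← (measurePreserving_eval μ i).lintegral_comp (hf i)]

theorem pi_withDensity {n : ℕ} {μ : Fin n → Measure ℝ} [∀ i, IsProbabilityMeasure (μ i)]
    {f : Fin n → ℝ → ENNReal} (hf : ∀ i, Measurable (f i))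
    [∀ i, SigmaFinite ((μ i).withDensity (f i))] :
    Measure.pi (fun i => (μ i).withDensity (f i)) =
      (Measure.pi μ).withDensity fun x => ∏ i, f i (x i) := by
  refine Measure.pi_eq fun s hs => ?_
  rw [withDensity_apply _ (MeasurableSet.univ_pi hs), ← lintegral_indicator (MeasurableSet.univ_pi hs)]
  have : (Set.univ.pi s).indicator (fun x : Fin n → ℝ => ∏ i, f i (x i)) =
      fun x => ∏ i, (s i).indicator (f i) (x i) := by
    ext x
    by_cases hx : x ∈ Set.univ.pi s
    · rw [Set.indicator_of_mem hx]
      exact Finset.prod_congr rfl fun i _ => (Set.indicator_of_mem (hx i (Set.mem_univ i)) _).symm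
    · rw [Set.indicator_of_notMem hx]
      simp only [Set.mem_univ_pi, not_forall] at hx
      obtain ⟨i, hi⟩ := hx
      exact (Finset.prod_eq_zero (Finset.mem_univ i) (Set.indicator_of_notMem hi _)).symm
  rw [this, lintegral_pi_prod fun i => (hf i).indicator (hs i)]
  refine Finset.prod_congr rfl fun i _ => ?_
  rw [lintegral_indicator (hs i), withDensity_apply _ (hs i)]

theorem stdGaussian_smul_le {n : ℕ} {K : Set (EuclideanSpace ℝ (Fin n))} (hK : MeasurableSet K)
    {ε : ℝ} (hε : 0 ≤ ε) :
    ProbabilityTheory.stdGaussian (EuclideanSpace ℝ (Fin n))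
        ((fun x => (1 + ε)⁻¹ • x) ⁻¹' K) ≤
      ∫⁻ x in K, ENNReal.ofReal (Real.exp (ε * (n - ‖x‖ ^ 2)))
        ∂ProbabilityTheory.stdGaussian (EuclideanSpace ℝ (Fin n)) := by
  have ht : 0 < 1 + ε := by linarith
  set p : ℝ → ENNReal := fun x =>
    ENNReal.ofReal ((1 + ε) * Real.exp (-(((1 + ε) ^ 2 - 1) * x ^ 2 / 2))) with hp
  have hpm : Measurable p := by fun_prop
  set μ := Measure.pi (fun _ : Fin n => gaussianReal 0 1) with hμ
  have hL : Measurable (WithLp.toLp 2 : (Fin n → ℝ) → EuclideanSpace ℝ (Fin n)) := by fun_prop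
  have hfin : IsProbabilityMeasure ((gaussianReal 0 1).withDensity p) := by
    rw [hp, ← gaussianReal_map_inv_mul_eq_withDensity ht]
    exact Measure.isProbabilityMeasure_map (by fun_prop)
  have hmap : μ.map (fun x i => (1 + ε)⁻¹ * x i) = μ.withDensity fun x => ∏ i, p (x i) := by
    have : IsProbabilityMeasure ((gaussianReal 0 1).map ((1 + ε)⁻¹ * ·)) :=
      Measure.isProbabilityMeasure_map (by fun_prop)
    rw [hμ, Measure.pi_map_pi (f := fun _ : Fin n => ((1 + ε)⁻¹ * ·)) (by fun_prop),
      ← pi_withDensity fun _ => hpm]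
    simp_rw [gaussianReal_map_inv_mul_eq_withDensity ht]
    rfl
  rw [← map_pi_eq_stdGaussian, Measure.map_apply hL
    ((show Measurable fun x : EuclideanSpace ℝ (Fin n) => (1 + ε)⁻¹ • x by fun_prop) hK),
    setLIntegral_map hK (by fun_prop) hL, ← hμ]
  calc _ = (μ.map (fun x i => (1 + ε)⁻¹ * x i)) (WithLp.toLp 2 ⁻¹' K) := by
        rw [Measure.map_apply (by fun_prop) (hL hK)]
        rfl
    _ = ∫⁻ x in WithLp.toLp 2 ⁻¹' K, ∏ i, p (x i) ∂μ := by
        rw [hmap, withDensity_apply _ (hL hK)]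
    _ ≤ _ := by
        refine lintegral_mono fun x => ?_
        simp only [hp]
        rw [← ENNReal.ofReal_prod_of_nonneg fun _ _ => by positivity]
        refine ENNReal.ofReal_le_ofReal ?_
        have : ε * (n - ‖WithLp.toLp 2 x‖ ^ 2) = ∑ i, ε * (1 - x i ^ 2) := by
          rw [EuclideanSpace.real_norm_sq_eq, ← Finset.mul_sum, Finset.sum_sub_distrib]
          simp
        rw [this, Real.exp_sum]
        refine Finset.prod_le_prod (fun _ _ => by positivity) fun i _ => ?_
        calc _ ≤ Real.exp ε * Real.exp (-(((1 + ε) ^ 2 - 1) * x i ^ 2 / 2)) := by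
              gcongr
              linarith [Real.add_one_le_exp ε]
          _ ≤ _ := by
              rw [← Real.exp_add, Real.exp_le_exp]
              nlinarith [mul_nonneg (sq_nonneg ε) (sq_nonneg (x i))]

theorem exp_le_one_add_self_add_sq {y : ℝ} (hy : y ≤ 1) : Real.exp y ≤ 1 + y + y ^ 2 := by
  by_cases h : -1 ≤ y
  · have := (abs_le.1 (Real.abs_exp_sub_one_sub_id_le (abs_le.2 ⟨h, hy⟩))).2
    linarith
  · have : Real.exp y ≤ 1 := Real.exp_le_one_iff.2 (by linarith)
    nlinarith

theorem integrable_sub_norm_sq_pow {n : ℕ} (c : ℝ) :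
    Integrable (fun x => c - ‖x‖ ^ 2)
        (ProbabilityTheory.stdGaussian (EuclideanSpace ℝ (Fin n))) ∧
      Integrable (fun x => (c - ‖x‖ ^ 2) ^ 2)
        (ProbabilityTheory.stdGaussian (EuclideanSpace ℝ (Fin n))) := by
  have h2 : Integrable (fun x => ‖x‖ ^ 2)
      (ProbabilityTheory.stdGaussian (EuclideanSpace ℝ (Fin n))) :=
    (IsGaussian.memLp_id _ 2 (by simp)).integrable_norm_pow (by simp)
  have h4 : Integrable (fun x => ‖x‖ ^ 4)
      (ProbabilityTheory.stdGaussian (EuclideanSpace ℝ (Fin n))) :=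
    (IsGaussian.memLp_id _ 4 (by simp)).integrable_norm_pow (by simp)
  refine ⟨(integrable_const c).sub h2, ?_⟩
  have : (fun x : EuclideanSpace ℝ (Fin n) => (c - ‖x‖ ^ 2) ^ 2) =
      fun x => c ^ 2 - 2 * c * ‖x‖ ^ 2 + ‖x‖ ^ 4 := by
    ext x
    ring
  rw [this]
  exact ((integrable_const _).sub (h2.const_mul _)).add h4

/-- The Gaussian volume of the dilate `(1 + ε) K` is at most
`vol(K) + ε · E[1_K (n - |x|²)] + C ε²`. -/
theorem exists_stdGaussian_smul_le {n : ℕ} {K : Set (EuclideanSpace ℝ (Fin n))}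
    (hK : MeasurableSet K) :
    ∃ C : ℝ, 0 ≤ C ∧ ∀ ε : ℝ, 0 ≤ ε →
      (ProbabilityTheory.stdGaussian (EuclideanSpace ℝ (Fin n))).real
          ((fun x => (1 + ε)⁻¹ • x) ⁻¹' K) ≤
        (ProbabilityTheory.stdGaussian (EuclideanSpace ℝ (Fin n))).real K +
          ε * (∫ x in K, (n - ‖x‖ ^ 2)
            ∂ProbabilityTheory.stdGaussian (EuclideanSpace ℝ (Fin n))) + C * ε ^ 2 := by
  set γ := ProbabilityTheory.stdGaussian (EuclideanSpace ℝ (Fin n)) with hγ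
  obtain ⟨i1, i2⟩ := integrable_sub_norm_sq_pow (n := n) n
  set D := ∫ x in K, (n - ‖x‖ ^ 2) ∂γ with hD
  set M := ∫ x in K, (n - ‖x‖ ^ 2) ^ 2 ∂γ with hM
  have hM0 : 0 ≤ M := integral_nonneg fun _ => sq_nonneg _
  refine ⟨M + n ^ 2 + n * |D|, by positivity, fun ε hε => ?_⟩
  by_cases hn : ε * n ≤ 1
  · have hint : Integrable (fun x => 1 + ε * (n - ‖x‖ ^ 2) + (ε * (n - ‖x‖ ^ 2)) ^ 2)
        (γ.restrict K) := by
      simp_rw [mul_pow]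
      exact (((integrable_const _).add (i1.const_mul _)).add (i2.const_mul _)).restrict
    have h1 : γ ((fun x => (1 + ε)⁻¹ • x) ⁻¹' K) ≤ ENNReal.ofReal
        (∫ x in K, (1 + ε * (n - ‖x‖ ^ 2) + (ε * (n - ‖x‖ ^ 2)) ^ 2) ∂γ) := by
      rw [ofReal_integral_eq_lintegral_ofReal hint
        (Filter.Eventually.of_forall fun x => by
          simp only [Pi.zero_apply]
          nlinarith [sq_nonneg (1 + ε * (n - ‖x‖ ^ 2)), sq_nonneg (ε * (n - ‖x‖ ^ 2))])]
      refine (stdGaussian_smul_le hK hε).trans (lintegral_mono fun x => ?_)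
      refine ENNReal.ofReal_le_ofReal (exp_le_one_add_self_add_sq ?_)
      nlinarith [mul_nonneg hε (sq_nonneg ‖x‖)]
    have h2 : ∫ x in K, (1 + ε * (n - ‖x‖ ^ 2) + (ε * (n - ‖x‖ ^ 2)) ^ 2) ∂γ =
        γ.real K + ε * D + M * ε ^ 2 := by
      simp_rw [mul_pow]
      have j1 : Integrable (fun x : EuclideanSpace ℝ (Fin n) => 1 + ε * (n - ‖x‖ ^ 2))
          (γ.restrict K) := ((integrable_const _).add (i1.const_mul _)).restrict
      rw [integral_add j1 (i2.const_mul _).restrict,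
        integral_add (integrable_const _) (i1.const_mul _).restrict,
        integral_const_mul, integral_const_mul, ← hD, ← hM]
      simp [hγ, mul_comm]
    have h3 : 0 ≤ γ.real K + ε * D + M * ε ^ 2 := by
      rw [← h2]
      refine integral_nonneg fun x => ?_
      simp only [Pi.zero_apply]
      nlinarith [sq_nonneg (1 + ε * (n - ‖x‖ ^ 2)), sq_nonneg (ε * (n - ‖x‖ ^ 2))]
    rw [h2] at h1
    have h4 := ENNReal.toReal_le_of_le_ofReal h3 h1
    have h5 : 0 ≤ (n ^ 2 + n * |D|) * ε ^ 2 := by positivity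
    calc _ ≤ _ := h4
      _ ≤ _ := by linarith
  · push Not at hn
    have h1 : γ.real ((fun x => (1 + ε)⁻¹ • x) ⁻¹' K) ≤ 1 := measureReal_le_one
    have h2 : 0 ≤ γ.real K := measureReal_nonneg
    have h3 : 1 ≤ (n * ε) ^ 2 := by nlinarith
    have h4 : -(ε * D) ≤ n * |D| * ε ^ 2 := by
      have h5 : -(ε * D) ≤ ε * |D| := by nlinarith [neg_abs_le D]
      have h6 : 0 ≤ ε * |D| := by positivity
      nlinarith
    have h7 : 0 ≤ M * ε ^ 2 := by positivity
    nlinarith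

end Growth

section Influence

variable {n : ℕ} {K : Set (EuclideanSpace ℝ (Fin n))}

theorem integrable_sq_gaussianReal : Integrable (fun g : ℝ => g ^ 2) (gaussianReal 0 1) :=
  (memLp_id_gaussianReal 2).integrable_sq

theorem integral_sq_gaussianReal : ∫ g, g ^ 2 ∂gaussianReal 0 1 = 1 := by
  have h := variance_id_gaussianReal (μ := 0) (v := 1)
  rw [variance_of_integral_eq_zero (by fun_prop) (by simp)] at h
  simpa using h

theorem stdGaussian_gauge_shell_le (hK : Convex ℝ K) (hc : IsClosed K) (h0 : K ∈ nhds 0)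
    {ε b : ℝ} (hε : 0 ≤ ε)
    (hb : (ProbabilityTheory.stdGaussian (EuclideanSpace ℝ (Fin n))).real
          ((fun x => (1 + ε)⁻¹ • x) ⁻¹' K) ≤
        (ProbabilityTheory.stdGaussian (EuclideanSpace ℝ (Fin n))).real K + b) :
    ProbabilityTheory.stdGaussian (EuclideanSpace ℝ (Fin n)) {x | x ∉ K ∧ gauge K x ≤ 1 + ε} ≤
      ENNReal.ofReal b := by
  have hmem : ∀ x, gauge K x ≤ 1 ↔ x ∈ K := fun x => by
    rw [gauge_le_one_iff_mem_closure hK h0, hc.closure_eq]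
  have hsub : K ⊆ (fun x => (1 + ε)⁻¹ • x) ⁻¹' K := fun x hx => by
    rw [Set.mem_preimage, ← hmem, gauge_smul_of_nonneg (by positivity), smul_eq_mul,
      inv_mul_le_iff₀ (by positivity)]
    have := (hmem x).2 hx
    linarith
  have hset : {x | x ∉ K ∧ gauge K x ≤ 1 + ε} ⊆ ((fun x => (1 + ε)⁻¹ • x) ⁻¹' K) \ K := by
    rintro x ⟨hx, hg⟩
    refine ⟨?_, hx⟩
    rw [Set.mem_preimage, ← hmem, gauge_smul_of_nonneg (by positivity), smul_eq_mul,
      inv_mul_le_iff₀ (by positivity)]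
    linarith
  refine (measure_mono hset).trans ?_
  rw [← ofReal_measureReal, measureReal_sdiff hsub hc.measurableSet]
  exact ENNReal.ofReal_le_ofReal (by linarith)

theorem crossingProb_le (hK : Convex ℝ K) (hc : IsClosed K)
    (hb : Metric.ball 0 (1 / 4) ⊆ K) {A C : ℝ} (hA : 0 ≤ A) (hC : 0 ≤ C)
    (hg : ∀ ε : ℝ, 0 ≤ ε →
      (ProbabilityTheory.stdGaussian (EuclideanSpace ℝ (Fin n))).real
          ((fun x => (1 + ε)⁻¹ • x) ⁻¹' K) ≤
        (ProbabilityTheory.stdGaussian (EuclideanSpace ℝ (Fin n))).real K + (ε * A + C * ε ^ 2))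
    {τ : ℝ} (h0 : 0 ≤ τ) (h1 : τ ≤ 1) :
    crossingProb K τ ≤ τ * (A * (τ + 8) + 130 * C * τ) := by
  set γ := ProbabilityTheory.stdGaussian (EuclideanSpace ℝ (Fin n)) with hγ
  have hn : K ∈ nhds 0 := Filter.mem_of_superset (Metric.ball_mem_nhds 0 (by norm_num)) hb
  have hgc : Measurable (gauge K) := (continuous_gauge hK hn).measurable
  have hKm := hc.measurableSet
  have hS : MeasurableSet {p : EuclideanSpace ℝ (Fin n) × EuclideanSpace ℝ (Fin n) |
      p.1 ∉ K ∧ Real.cos τ • p.1 + Real.sin τ • p.2 ∈ K} := by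
    refine MeasurableSet.inter (measurable_fst hKm.compl) ?_
    exact (show Measurable fun p : EuclideanSpace ℝ (Fin n) × EuclideanSpace ℝ (Fin n) =>
      Real.cos τ • p.1 + Real.sin τ • p.2 by fun_prop) hKm
  have hT : MeasurableSet {p : EuclideanSpace ℝ (Fin n) × ℝ |
      p.1 ∉ K ∧ gauge K p.1 ≤ 1 + τ ^ 2 + 8 * τ * |p.2|} := by
    refine MeasurableSet.inter (measurable_fst hKm.compl) ?_
    exact measurableSet_le (hgc.comp measurable_fst) (by fun_prop)
  have hbound : ∀ g : ℝ, γ {x | x ∉ K ∧ gauge K x ≤ 1 + τ ^ 2 + 8 * τ * |g|} ≤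
      ENNReal.ofReal (τ * (A * (τ + 4 + 4 * g ^ 2) + C * τ * (2 + 128 * g ^ 2))) := by
    intro g
    have hε : 0 ≤ τ ^ 2 + 8 * τ * |g| := by positivity
    rw [show 1 + τ ^ 2 + 8 * τ * |g| = 1 + (τ ^ 2 + 8 * τ * |g|) by ring]
    refine (stdGaussian_gauge_shell_le hK hc hn hε (hg _ hε)).trans (ENNReal.ofReal_le_ofReal ?_)
    have e1 : τ ^ 2 + 8 * τ * |g| ≤ τ * (τ + 4 + 4 * g ^ 2) := by
      have : 8 * |g| ≤ 4 + 4 * g ^ 2 := by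
        nlinarith [sq_nonneg (|g| - 1), sq_abs g]
      nlinarith
    have e2 : (τ ^ 2 + 8 * τ * |g|) ^ 2 ≤ τ ^ 2 * (2 + 128 * g ^ 2) := by
      have : (τ + 8 * |g|) ^ 2 ≤ 2 + 128 * g ^ 2 := by
        nlinarith [sq_nonneg (τ - 8 * |g|), sq_abs g]
      calc _ = τ ^ 2 * (τ + 8 * |g|) ^ 2 := by ring
        _ ≤ _ := by gcongr
    nlinarith [mul_le_mul_of_nonneg_left e1 hA, mul_le_mul_of_nonneg_left e2 hC]
  have hmain : (γ.prod γ) {p | p.1 ∉ K ∧ Real.cos τ • p.1 + Real.sin τ • p.2 ∈ K} ≤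
      ENNReal.ofReal (τ * (A * (τ + 8) + 130 * C * τ)) := by
    calc _ = ∫⁻ x, γ {y | x ∉ K ∧ Real.cos τ • x + Real.sin τ • y ∈ K} ∂γ := by
          rw [Measure.prod_apply hS]
          rfl
      _ ≤ ∫⁻ x, gaussianReal 0 1 {g | x ∉ K ∧ gauge K x ≤ 1 + τ ^ 2 + 8 * τ * |g|} ∂γ := by
          refine lintegral_mono fun x => ?_
          by_cases hx : x ∈ K
          · simp [hx]
          · simp only [hx, not_false_eq_true, true_and]
            refine stdGaussian_rotation_mem_le hK hb ?_ h0 h1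
            by_contra! h
            rw [gauge_le_one_iff_mem_closure hK hn, hc.closure_eq] at h
            exact hx h
      _ = (γ.prod (gaussianReal 0 1))
            {p | p.1 ∉ K ∧ gauge K p.1 ≤ 1 + τ ^ 2 + 8 * τ * |p.2|} := by
          rw [Measure.prod_apply hT]
          rfl
      _ = ∫⁻ g, γ {x | x ∉ K ∧ gauge K x ≤ 1 + τ ^ 2 + 8 * τ * |g|} ∂gaussianReal 0 1 := by
          rw [Measure.prod_apply_symm hT]
          rfl
      _ ≤ ∫⁻ g, ENNReal.ofReal
            (τ * (A * (τ + 4 + 4 * g ^ 2) + C * τ * (2 + 128 * g ^ 2))) ∂gaussianReal 0 1 :=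
          lintegral_mono hbound
      _ = _ := by
          have e : ∀ g : ℝ, τ * (A * (τ + 4 + 4 * g ^ 2) + C * τ * (2 + 128 * g ^ 2)) =
              τ * (A * (τ + 4) + 2 * C * τ) + τ * (4 * A + 128 * C * τ) * g ^ 2 := fun g => by
            ring
          have hi := integrable_sq_gaussianReal.const_mul (τ * (4 * A + 128 * C * τ))
          simp_rw [e]
          have hj : Integrable (fun g : ℝ => τ * (A * (τ + 4) + 2 * C * τ) +
              τ * (4 * A + 128 * C * τ) * g ^ 2) (gaussianReal 0 1) := (integrable_const _).add hi
          rw [← ofReal_integral_eq_lintegral_ofReal hj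
            (Filter.Eventually.of_forall fun g => by simp only [Pi.zero_apply]; positivity),
            integral_add (integrable_const _) hi, integral_const, integral_const_mul,
            integral_sq_gaussianReal]
          congr 1
          simp
          ring
  exact ENNReal.toReal_le_of_le_ofReal (by positivity) hmain

/-- The total influence `E[1_K (n - |x|²)]` of a symmetric convex set of Gaussian volume
bounded away from `0` and `1` is bounded below by an absolute constant. -/
theorem total_influence_ge (hK : Convex ℝ K) (hc : IsClosed K) (hs : ∀ x ∈ K, -x ∈ K)
    (h1 : 1 / 4 ≤ (ProbabilityTheory.stdGaussian (EuclideanSpace ℝ (Fin n))).real K)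
    (h2 : (ProbabilityTheory.stdGaussian (EuclideanSpace ℝ (Fin n))).real K ≤ 3 / 4) :
    1 / 100 ≤ ∫ x in K, (n - ‖x‖ ^ 2)
      ∂ProbabilityTheory.stdGaussian (EuclideanSpace ℝ (Fin n)) := by
  have hb := ball_subset_of_stdGaussian_ge hK hc hs h1
  obtain ⟨C, hC, hg⟩ := exists_stdGaussian_smul_le hc.measurableSet
  set D := ∫ x in K, (n - ‖x‖ ^ 2)
    ∂ProbabilityTheory.stdGaussian (EuclideanSpace ℝ (Fin n)) with hD
  by_contra! hlt
  obtain ⟨N, hN⟩ := exists_nat_gt (100 * (1 + 130 * C))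
  have hN0 : 0 < (N : ℝ) := by linarith
  have hpi := Real.pi_lt_d2
  have hpi3 := Real.pi_gt_three
  set τ := Real.pi / (2 * N) with hτ
  have hNτ : N * τ = Real.pi / 2 := by
    rw [hτ]
    field_simp
  have hτ0 : 0 ≤ τ := by positivity
  have hsmall : τ * (1 + 130 * C) ≤ 1 / 50 := by
    have : τ * (100 * (1 + 130 * C)) ≤ τ * N := by gcongr
    linarith
  have hτ1 : τ ≤ 1 := by nlinarith [mul_nonneg hτ0 hC]
  have hcr := crossingProb_le hK hc hb (A := 1 / 100) (by norm_num) hC (fun ε hε => by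
    have := hg ε hε
    have h3 : ε * D ≤ ε * (1 / 100) := by gcongr
    linarith) hτ0 hτ1
  have hmul := crossingProb_nat_mul_le hc.measurableSet τ N
  rw [hNτ, crossingProb_pi_div_two K hc.measurableSet] at hmul
  set v := (ProbabilityTheory.stdGaussian (EuclideanSpace ℝ (Fin n))).real K
  have hv : 3 / 16 ≤ (1 - v) * v := by nlinarith
  have h4 : N * crossingProb K τ ≤ N * (τ * (1 / 100 * (τ + 8) + 130 * C * τ)) := by gcongr
  rw [← mul_assoc, hNτ] at h4
  have h5 : 1 / 100 * (τ + 8) + 130 * C * τ ≤ 1 / 10 := by nlinarith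
  have h6 : Real.pi / 2 * (1 / 100 * (τ + 8) + 130 * C * τ) ≤ 3.15 / 2 * (1 / 10) := by gcongr
  norm_num at h6
  linarith

end Influence

section Closure

variable {n : ℕ} {K : Set (EuclideanSpace ℝ (Fin n))}

theorem interior_closure_subset_of_ball_subset_closure (hK : Convex ℝ K) {r : ℝ} (hr : 0 < r)
    (hb : Metric.ball 0 r ⊆ closure K) : interior (closure K) ⊆ K := by
  have hspan : affineSpan ℝ K = ⊤ := by
    have hcl : closure K ⊆ affineSpan ℝ K :=
      closure_minimal (subset_affineSpan ℝ K) (AffineSubspace.closed_of_finiteDimensional _)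
    have hball := Metric.isOpen_ball.affineSpan_eq_top
      (Metric.nonempty_ball.2 hr : (Metric.ball (0 : EuclideanSpace ℝ (Fin n)) r).Nonempty)
    rw [eq_top_iff, ← hball]
    exact affineSpan_le.2 (hb.trans hcl)
  rw [hK.interior_closure_eq_interior_of_nonempty_interior
    (hK.interior_nonempty_iff_affineSpan_eq_top.2 hspan)]
  exact interior_subset

theorem stdGaussian_frontier_eq_zero (hK : Convex ℝ K) (h0 : K ∈ nhds 0) :
    ProbabilityTheory.stdGaussian (EuclideanSpace ℝ (Fin n)) (K \ interior K) = 0 := by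
  set γ := ProbabilityTheory.stdGaussian (EuclideanSpace ℝ (Fin n)) with hγ
  obtain ⟨C, hC, hg⟩ := exists_stdGaussian_smul_le (K := interior K) isOpen_interior.measurableSet
  rw [← hγ] at hg
  set D := ∫ x in interior K, (n - ‖x‖ ^ 2) ∂γ
  have hle : ∀ ε : ℝ, 0 < ε → γ.real K ≤ γ.real (interior K) + ε * D + C * ε ^ 2 := by
    intro ε hε
    refine le_trans (measureReal_mono fun x hx => ?_) (hg ε hε.le)
    rw [Set.mem_preimage, ← gauge_lt_one_iff_mem_interior hK h0,
      gauge_smul_of_nonneg (by positivity), smul_eq_mul, inv_mul_lt_iff₀ (by positivity)]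
    have := gauge_le_one_of_mem hx
    linarith
  have hlim : Filter.Tendsto (fun ε : ℝ => γ.real (interior K) + ε * D + C * ε ^ 2)
      (nhdsWithin 0 (Set.Ioi 0)) (nhds (γ.real (interior K) + 0 * D + C * 0 ^ 2)) :=
    (Continuous.tendsto (by fun_prop) 0).mono_left nhdsWithin_le_nhds
  have h1 := ge_of_tendsto hlim (eventually_nhdsWithin_of_forall hle)
  have h2 : γ.real (K \ interior K) = 0 := by
    rw [measureReal_sdiff interior_subset isOpen_interior.measurableSet]
    have := measureReal_mono (μ := γ) (interior_subset (s := K))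
    linarith
  exact (measureReal_eq_zero_iff).1 h2

end Closure

section Hermite

theorem stdGaussian_eq_stdGaussian (n : ℕ) :
    _root_.stdGaussian n = ProbabilityTheory.stdGaussian (EuclideanSpace ℝ (Fin n)) := by
  rw [← map_pi_eq_stdGaussian]
  rfl

theorem prod_normHermite_single_two {n : ℕ} (i : Fin n) (x : EuclideanSpace ℝ (Fin n)) :
    ∏ j, normHermite ((Pi.single i 2 : Fin n → ℕ) j) (x j) = (x i ^ 2 - 1) / √2 := by
  rw [Finset.prod_eq_single i]
  · simp [normHermite, Polynomial.hermite_succ]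
    ring
  · intro j _ hj
    simp [normHermite, hj]
  · simp

theorem integrable_coord_sq {n : ℕ} (i : Fin n) :
    Integrable (fun x => x i ^ 2)
      (ProbabilityTheory.stdGaussian (EuclideanSpace ℝ (Fin n))) :=
  (IsGaussian.memLp_dual _ (EuclideanSpace.proj i : StrongDual ℝ (EuclideanSpace ℝ (Fin n))) 2
    (by simp)).integrable_sq

theorem integral_coord_sq {n : ℕ} (i : Fin n) :
    ∫ x, x i ^ 2 ∂ProbabilityTheory.stdGaussian (EuclideanSpace ℝ (Fin n)) = 1 := by
  have h : MeasurePreserving (fun x : Fin n → ℝ => x i)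
      (Measure.pi fun _ => gaussianReal 0 1) (gaussianReal 0 1) := measurePreserving_eval _ i
  have hm := integral_map h.aemeasurable (f := fun g : ℝ => g ^ 2) (by fun_prop)
  rw [h.map_eq, integral_sq_gaussianReal] at hm
  rw [← map_pi_eq_stdGaussian, integral_map (by fun_prop) (by fun_prop)]
  exact hm.symm

theorem hermiteCoeff_pmInd_single_two {n : ℕ} {K L : Set (EuclideanSpace ℝ (Fin n))}
    (hL : MeasurableSet L)
    (hKL : K =ᵐ[ProbabilityTheory.stdGaussian (EuclideanSpace ℝ (Fin n))] L) (i : Fin n) :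
    hermiteCoeff n (pmInd K) (Pi.single i 2) = √2 * ∫ x in L, (x i ^ 2 - 1)
      ∂ProbabilityTheory.stdGaussian (EuclideanSpace ℝ (Fin n)) := by
  set γ := ProbabilityTheory.stdGaussian (EuclideanSpace ℝ (Fin n)) with hγ
  have hi : Integrable (fun x : EuclideanSpace ℝ (Fin n) => x i ^ 2 - 1) γ :=
    (integrable_coord_sq i).sub (integrable_const 1)
  have h2 : (√2 : ℝ) * √2 = 2 := Real.mul_self_sqrt (by norm_num)
  have h2' : (√2 : ℝ) ≠ 0 := by positivity
  have hae : (fun x => pmInd K x * ∏ j, normHermite ((Pi.single i 2 : Fin n → ℕ) j) (x j)) =ᵐ[γ]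
      fun x => √2 * L.indicator (fun x => x i ^ 2 - 1) x - (√2)⁻¹ * (x i ^ 2 - 1) := by
    filter_upwards [hKL.mem_iff] with x hx
    rw [prod_normHermite_single_two, pmInd]
    by_cases hxL : x ∈ L
    · rw [if_pos (hx.2 hxL), Set.indicator_of_mem hxL]
      field_simp
      linear_combination (-(x i ^ 2 - 1)) * h2
    · rw [if_neg (fun h => hxL (hx.1 h)), Set.indicator_of_notMem hxL]
      field_simp
      ring
  rw [hermiteCoeff, stdGaussian_eq_stdGaussian, ← hγ, integral_congr_ae hae,
    integral_sub ((hi.indicator hL).const_mul _) (hi.const_mul _), integral_const_mul,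
    integral_const_mul, integral_indicator hL, integral_sub (integrable_coord_sq i)
    (integrable_const 1), integral_coord_sq]
  simp

theorem sum_hermiteCoeff_single_two {n : ℕ} {K L : Set (EuclideanSpace ℝ (Fin n))}
    (hL : MeasurableSet L)
    (hKL : K =ᵐ[ProbabilityTheory.stdGaussian (EuclideanSpace ℝ (Fin n))] L) :
    ∑ i, hermiteCoeff n (pmInd K) (Pi.single i 2) = -(√2 * ∫ x in L, (n - ‖x‖ ^ 2)
      ∂ProbabilityTheory.stdGaussian (EuclideanSpace ℝ (Fin n))) := by
  simp_rw [hermiteCoeff_pmInd_single_two hL hKL]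
  rw [← Finset.mul_sum, ← integral_finsetSum, ← mul_neg, ← integral_neg]
  · congr 2
    ext x
    rw [EuclideanSpace.real_norm_sq_eq, Finset.sum_sub_distrib]
    simp
  · exact fun i _ => ((integrable_coord_sq i).sub (integrable_const 1)).restrict

theorem sum_sq_hermiteCoeff_le_hermiteWeight (n : ℕ) (f : EuclideanSpace ℝ (Fin n) → ℝ) :
    ∑ i, hermiteCoeff n f (Pi.single i 2) ^ 2 ≤ hermiteWeight n f 2 := by
  have hfin : Finite {S : Fin n → ℕ // ∑ i, S i = 2} := by
    refine Set.Finite.to_subtype ((Set.Finite.pi' fun _ : Fin n => Set.finite_Iic 2).subset ?_)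
    intro S hS i
    have hS' : ∑ i, S i = 2 := hS
    rw [Set.mem_Iic, ← hS']
    exact Finset.single_le_sum (fun _ _ => Nat.zero_le _) (Finset.mem_univ i)
  let e : Fin n → {S : Fin n → ℕ // ∑ i, S i = 2} := fun i => ⟨Pi.single i 2, by simp⟩
  have he : Function.Injective e := fun i j h => by
    by_contra hne
    have := congrFun (congrArg Subtype.val h) i
    simp [e, hne] at this
  have hle := tsum_comp_le_tsum_of_inj (f := fun S : {S : Fin n → ℕ // ∑ i, S i = 2} =>
    hermiteCoeff n f S.1 ^ 2) Summable.of_finite (fun _ => sq_nonneg _) he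
  rw [tsum_fintype] at hle
  exact hle

end Hermite

/-- A centrally symmetric convex set whose Gaussian volume is within `c/√n` of `1/2`
has Hermite weight at least `c'/n` at level 2. -/
theorem level_two_hermite_weight_symmetric :
    ∃ c c' : ℝ, 0 < c ∧ 0 < c' ∧ ∃ n₀ : ℕ, ∀ n : ℕ, n₀ ≤ n →
      ∀ K : Set (EuclideanSpace ℝ (Fin n)),
        Convex ℝ K → (∀ x, x ∈ K ↔ -x ∈ K) →
        |gaussVol n K - 1 / 2| ≤ c / Real.sqrt n →
        c' / (n : ℝ) ≤ hermiteWeight n (pmInd K) 2 := by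
  refine ⟨1 / 4, 1 / 5000, by norm_num, by norm_num, 1, fun n hn K hK hsymm hvol => ?_⟩
  set γ := ProbabilityTheory.stdGaussian (EuclideanSpace ℝ (Fin n)) with hγ
  have hn1 : (1 : ℝ) ≤ n := by exact_mod_cast hn
  have hvol' : |γ.real K - 1 / 2| ≤ 1 / 4 := by
    rw [gaussVol, stdGaussian_eq_stdGaussian] at hvol
    refine hvol.trans (div_le_self (by norm_num) ?_)
    exact Real.one_le_sqrt.2 hn1
  obtain ⟨hv1, hv2⟩ := abs_le.1 hvol'
  have hLs : ∀ x ∈ closure K, -x ∈ closure K := fun x hx =>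
    map_mem_closure continuous_neg hx fun y hy => (hsymm y).1 hy
  have hL1 : 1 / 4 ≤ γ.real (closure K) := by
    have := measureReal_mono (μ := γ) (subset_closure (s := K))
    linarith
  have hb := ball_subset_of_stdGaussian_ge hK.closure isClosed_closure hLs hL1
  have h0 : closure K ∈ nhds 0 :=
    Filter.mem_of_superset (Metric.ball_mem_nhds 0 (by norm_num)) hb
  have hKL : K =ᵐ[γ] closure K := by
    refine subset_closure.eventuallyLE.antisymm (ae_le_set.2 ?_)
    refine measure_mono_null (Set.sdiff_subset_sdiff_right ?_)
      (stdGaussian_frontier_eq_zero hK.closure h0)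
    exact interior_closure_subset_of_ball_subset_closure hK (by norm_num) hb
  have hL2 : γ.real (closure K) ≤ 3 / 4 := by
    rw [← measureReal_congr hKL]
    linarith
  have hD := total_influence_ge hK.closure isClosed_closure hLs hL1 hL2
  have hsum := sum_hermiteCoeff_single_two isClosed_closure.measurableSet hKL
  have hcs := sq_sum_le_card_mul_sum_sq (s := Finset.univ)
    (f := fun i => hermiteCoeff n (pmInd K) (Pi.single i 2))
  have hW := sum_sq_hermiteCoeff_le_hermiteWeight n (pmInd K)
  rw [hsum, neg_sq, mul_pow, Real.sq_sqrt (by norm_num), Finset.card_univ, Fintype.card_fin] at hcs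
  rw [div_le_iff₀ (by linarith)]
  nlinarith
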